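/- arXiv:math/0012123 — 2 statements merged into one kernel-verified Lean document; each statement's English description precedes it below -/
import Mathlib

section
/- Let H be a finite-dimensional Hermitian symplectic space and let V, W be Lagrangian subspaces of H. Then m_H(W, V) = −m_H(V, W). -/
noncomputable section

variable {H : Type*} [NormedAddCommGroup H] [InnerProductSpace ℂ H] [FiniteDimensional ℂ H]

/-- The `c`-eigenspace `ker (γ - c·id)` of `γ`. -/
def eigSp (γ : H →ₗ[ℂ] H) (c : ℂ) : Submodule ℂ H :=
  LinearMap.ker (γ - c • (LinearMap.id : H →ₗ[ℂ] H))

/-- The Lagrangian `V` is the graph of the unitary `φ : E_i → E_{-i}`,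
i.e. `V = {x + φ x : x ∈ E_i}`. -/
def IsGraphOf (γ : H →ₗ[ℂ] H) (V : Submodule ℂ H)
    (φ : eigSp γ Complex.I ≃ₗᵢ[ℂ] eigSp γ (-Complex.I)) : Prop :=
  (V : Set H) =
    Set.range fun x : eigSp γ Complex.I => (x : H) + ((φ x : eigSp γ (-Complex.I)) : H)

/-- `m_H(V, W) = -(1/(πi)) Σ_{λ ≠ -1} (mult of λ) · log λ`, the sum over the
eigenvalues `λ ≠ -1` of the unitary `-φ(V)φ(W)*` of `E_{-i}`, where `log` is the
branch with `log(r e^{it}) = ln r + it`, `-π < t ≤ π`. -/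
def mH (γ : H →ₗ[ℂ] H)
    (φV φW : eigSp γ Complex.I ≃ₗᵢ[ℂ] eigSp γ (-Complex.I)) : ℂ :=
  -(1 / ((Real.pi : ℂ) * Complex.I)) *
    ∑ᶠ (z : ℂ) (_ : z ≠ -1),
      (Module.finrank ℂ
        (Module.End.eigenspace
          (-((φW.symm.trans φV).toLinearEquiv :
              eigSp γ (-Complex.I) →ₗ[ℂ] eigSp γ (-Complex.I))) z) : ℂ) *
        Complex.log z

/-- The eigenspaces of `-(φW φV⁻¹)` at `z⁻¹` and of `-(φV φW⁻¹)` at `z` agree. -/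
lemma eigenspace_inv_aux {E F : Type*} [NormedAddCommGroup E] [InnerProductSpace ℂ E]
    [NormedAddCommGroup F] [InnerProductSpace ℂ F] (φV φW : E ≃ₗᵢ[ℂ] F) {z : ℂ} (hz : z ≠ 0) :
    Module.End.eigenspace (-((φV.symm.trans φW).toLinearEquiv : F →ₗ[ℂ] F)) z⁻¹ =
      Module.End.eigenspace (-((φW.symm.trans φV).toLinearEquiv : F →ₗ[ℂ] F)) z := by
  ext x
  simp only [Module.End.mem_eigenspace_iff, LinearMap.neg_apply]
  change -(φW (φV.symm x)) = z⁻¹ • x ↔ -(φV (φW.symm x)) = z • x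
  constructor
  · intro h
    have h2 : x = -(z • φW (φV.symm x)) := by
      rw [← smul_neg, h, smul_smul, mul_inv_cancel₀ hz, one_smul]
    conv_lhs => rw [h2]
    simp
  · intro h
    have h2 : x = -(z⁻¹ • φV (φW.symm x)) := by
      rw [← smul_neg, h, smul_smul, inv_mul_cancel₀ hz, one_smul]
    conv_lhs => rw [h2]
    simp

/-- Eigenvalues have modulus one. -/
lemma eigenspace_norm_aux {E F : Type*} [NormedAddCommGroup E] [InnerProductSpace ℂ E]
    [NormedAddCommGroup F] [InnerProductSpace ℂ F] (φV φW : E ≃ₗᵢ[ℂ] F) {z : ℂ} (hz : ‖z‖ ≠ 1) :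
    Module.End.eigenspace (-((φW.symm.trans φV).toLinearEquiv : F →ₗ[ℂ] F)) z = ⊥ := by
  rw [eq_bot_iff]
  intro x hx
  rw [Module.End.mem_eigenspace_iff, LinearMap.neg_apply] at hx
  change -(φV (φW.symm x)) = z • x at hx
  have h := congrArg norm hx
  rw [norm_neg, LinearIsometryEquiv.norm_map, LinearIsometryEquiv.norm_map, norm_smul] at h
  rw [Submodule.mem_bot]
  by_contra hne
  have hpos : ‖x‖ ≠ 0 := norm_ne_zero_iff.mpr hne
  apply hz
  exact (mul_right_cancel₀ hpos (by rw [one_mul]; exact h)).symm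

/-- `m_H(W, V) = -m_H(V, W)` for Lagrangian subspaces `V, W` of a
finite-dimensional Hermitian symplectic space. -/
theorem statement15 (γ : H →ₗ[ℂ] H) (hsq : ∀ x, γ (γ x) = -x)
    (hadj : LinearMap.adjoint γ = -γ)
    (hdim : Module.finrank ℂ (eigSp γ Complex.I) =
      Module.finrank ℂ (eigSp γ (-Complex.I)))
    (V W : Submodule ℂ H) (hV : V.map γ = Vᗮ) (hW : W.map γ = Wᗮ)
    (φV φW : eigSp γ Complex.I ≃ₗᵢ[ℂ] eigSp γ (-Complex.I))
    (hφV : IsGraphOf γ V φV) (hφW : IsGraphOf γ W φW) :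
    mH γ φW φV = -mH γ φV φW := by
  unfold mH
  rw [← mul_neg]
  congr 1
  rw [← finsum_neg_distrib, ← finsum_comp_equiv (Equiv.inv ℂ)]
  refine finsum_congr fun z => ?_
  rw [← finsum_neg_distrib]
  simp only [Equiv.inv_apply]
  have hiff : z⁻¹ ≠ -1 ↔ z ≠ -1 := by
    rw [not_iff_not, inv_eq_iff_eq_inv, inv_neg, inv_one]
  refine finsum_congr_Prop (propext hiff) fun hz => ?_
  by_cases h0 : z = 0
  · simp [h0]
  rw [Equiv.inv_apply, eigenspace_inv_aux φV φW h0]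
  by_cases h1 : ‖z‖ = 1
  · have harg : z.arg ≠ Real.pi := by
      intro h
      apply hz
      have := Complex.norm_mul_exp_arg_mul_I z
      rw [h, h1, Complex.exp_pi_mul_I] at this
      rw [← this]
      simp
    rw [Complex.log_inv z harg, mul_neg]
  · rw [eigenspace_norm_aux φV φW h1]
    simp
end
end

section
/- Let H be a finite-dimensional Hermitian symplectic space and let V, W, U be Lagrangian subspaces of H. Then the real number σ̃_H(V, W, U) := m_H(V, W) + m_H(W, U) + m_H(U, V) is an integer. -/
noncomputable section

variable {H : Type*} [NormedAddCommGroup H] [InnerProductSpace ℂ H] [FiniteDimensional ℂ H]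

/-- An isometric endomorphism of a finite-dimensional inner product space is semisimple. -/
lemma isSemisimple_of_isometric {E : Type*} [NormedAddCommGroup E] [InnerProductSpace ℂ E]
    [FiniteDimensional ℂ E] (T : Module.End ℂ E)
    (hT : ∀ x y, inner ℂ (T x) (T y) = inner ℂ x y) : T.IsSemisimple := by
  have hinj : Function.Injective T := by
    rw [injective_iff_map_eq_zero]
    intro x hx
    have := hT x x
    rw [hx, inner_zero_left] at this
    exact inner_self_eq_zero.mp this.symm
  rw [Module.End.isSemisimple_iff]
  intro p hp
  refine ⟨pᗮ, ?_, Submodule.isCompl_orthogonal p⟩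
  have hmap : p.map T = p := by
    apply Submodule.eq_of_le_of_finrank_eq
    · exact Submodule.map_le_iff_le_comap.mpr hp
    · exact (Submodule.equivMapOfInjective T hinj p).finrank_eq.symm
  intro x hx
  rw [Submodule.mem_comap, Submodule.mem_orthogonal]
  intro y hy
  rw [← hmap] at hy
  obtain ⟨y', hy', rfl⟩ := hy
  rw [hT]
  exact (Submodule.mem_orthogonal _ _).mp hx y' hy'

/-- The exponential of the logarithm sum is the determinant up to sign. -/
lemma exp_sum_log {E : Type*} [NormedAddCommGroup E] [InnerProductSpace ℂ E]
    [FiniteDimensional ℂ E] (T : Module.End ℂ E)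
    (hT : ∀ x y, inner ℂ (T x) (T y) = inner ℂ x y) :
    ∃ n : ℕ, Complex.exp (∑ᶠ (z : ℂ) (_ : z ≠ -1),
      (Module.finrank ℂ (Module.End.eigenspace T z) : ℂ) * Complex.log z) * (-1) ^ n =
      LinearMap.det T := by
  classical
  have hss := isSemisimple_of_isometric T hT
  have hfr : ∀ z, Module.finrank ℂ (Module.End.eigenspace T z) = T.charpoly.roots.count z := by
    intro z
    rw [← (Module.End.isFinitelySemisimple_iff_isSemisimple.mpr
      hss).maxGenEigenspace_eq_eigenspace, LinearMap.finrank_maxGenEigenspace_eq,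
      Polynomial.count_roots]
  have hz0 : ∀ z ∈ T.charpoly.roots, z ≠ 0 := by
    rintro z hz rfl
    have h1 : T.charpoly.roots.count 0 ≠ 0 := Multiset.count_ne_zero.mpr hz
    rw [← hfr] at h1
    apply h1
    rw [Submodule.finrank_eq_zero, Submodule.eq_bot_iff]
    intro x hx
    rw [Module.End.mem_eigenspace_iff, zero_smul] at hx
    have := hT x x
    rw [hx, inner_zero_left] at this
    exact inner_self_eq_zero.mp this.symm
  have hsum : (∑ᶠ (z : ℂ) (_ : z ≠ -1),
      (Module.finrank ℂ (Module.End.eigenspace T z) : ℂ) * Complex.log z) =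
      ∑ z ∈ T.charpoly.roots.toFinset, if z ≠ -1 then
        (T.charpoly.roots.count z : ℂ) * Complex.log z else 0 := by
    have h1 : ∀ z : ℂ, (∑ᶠ (_ : z ≠ -1),
      (Module.finrank ℂ (Module.End.eigenspace T z) : ℂ) * Complex.log z) =
      if z ≠ -1 then (T.charpoly.roots.count z : ℂ) * Complex.log z else 0 := by
      intro z
      rw [finsum_eq_if, hfr]
    rw [finsum_congr h1]
    apply finsum_eq_sum_of_support_subset
    intro z hz
    by_contra hmem
    apply hz
    have : T.charpoly.roots.count z = 0 := by
      rw [Multiset.count_eq_zero]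
      simpa only [Finset.mem_coe, Multiset.mem_toFinset] using hmem
    simp [this]
  refine ⟨T.charpoly.roots.count (-1), ?_⟩
  rw [Module.End.det_eq_prod_roots_charpoly_of_splits (IsAlgClosed.splits _),
    Finset.prod_multiset_count, hsum, Complex.exp_sum]
  have h2 : ((-1 : ℂ)) ^ (T.charpoly.roots.count (-1)) =
      ∏ z ∈ T.charpoly.roots.toFinset,
        if z = -1 then z ^ (T.charpoly.roots.count z) else 1 := by
    by_cases hm : (-1 : ℂ) ∈ T.charpoly.roots.toFinset
    · rw [Finset.prod_eq_single_of_mem _ hm (fun b _ hb => if_neg hb), if_pos rfl]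
    · rw [Finset.prod_eq_one (fun b hb => if_neg (fun h : b = -1 => hm (h ▸ hb)))]
      rw [Multiset.mem_toFinset] at hm
      rw [Multiset.count_eq_zero.mpr hm, pow_zero]
  rw [h2, ← Finset.prod_mul_distrib]
  apply Finset.prod_congr rfl
  intro z hz
  rw [Multiset.mem_toFinset] at hz
  by_cases h : z = -1
  · simp [h]
  · simp only [ne_eq, h, not_false_eq_true, if_true, if_false, mul_one]
    rw [Complex.exp_nat_mul, Complex.exp_log (hz0 z hz)]

/-- For Lagrangian subspaces `V, W, U`, the number
`σ̃_H(V,W,U) = m_H(V,W) + m_H(W,U) + m_H(U,V)` is an integer. -/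
theorem statement17 (γ : H →ₗ[ℂ] H) (hsq : ∀ x, γ (γ x) = -x)
    (hadj : LinearMap.adjoint γ = -γ)
    (hdim : Module.finrank ℂ (eigSp γ Complex.I) =
      Module.finrank ℂ (eigSp γ (-Complex.I)))
    (V W U : Submodule ℂ H) (hV : V.map γ = Vᗮ) (hW : W.map γ = Wᗮ) (hU : U.map γ = Uᗮ)
    (φV φW φU : eigSp γ Complex.I ≃ₗᵢ[ℂ] eigSp γ (-Complex.I))
    (hφV : IsGraphOf γ V φV) (hφW : IsGraphOf γ W φW) (hφU : IsGraphOf γ U φU) :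
    ∃ n : ℤ, mH γ φV φW + mH γ φW φU + mH γ φU φV = (n : ℂ) := by
  have key : ∀ a b : eigSp γ Complex.I ≃ₗᵢ[ℂ] eigSp γ (-Complex.I), _ := fun a b =>
    exp_sum_log (-((b.symm.trans a).toLinearEquiv :
              eigSp γ (-Complex.I) →ₗ[ℂ] eigSp γ (-Complex.I))) (by
      intro x y
      simp only [LinearMap.neg_apply, inner_neg_neg]
      exact (b.symm.trans a).inner_map_map x y)
  obtain ⟨n1, h1⟩ := key φV φW
  obtain ⟨n2, h2⟩ := key φW φU
  obtain ⟨n3, h3⟩ := key φU φV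
  unfold mH
  set S1 := ∑ᶠ (z : ℂ) (_ : z ≠ -1), (Module.finrank ℂ (Module.End.eigenspace
          (-((φW.symm.trans φV).toLinearEquiv :
              eigSp γ (-Complex.I) →ₗ[ℂ] eigSp γ (-Complex.I))) z) : ℂ) * Complex.log z
  set S2 := ∑ᶠ (z : ℂ) (_ : z ≠ -1), (Module.finrank ℂ (Module.End.eigenspace
          (-((φU.symm.trans φW).toLinearEquiv :
              eigSp γ (-Complex.I) →ₗ[ℂ] eigSp γ (-Complex.I))) z) : ℂ) * Complex.log z
  set S3 := ∑ᶠ (z : ℂ) (_ : z ≠ -1), (Module.finrank ℂ (Module.End.eigenspace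
          (-((φV.symm.trans φU).toLinearEquiv :
              eigSp γ (-Complex.I) →ₗ[ℂ] eigSp γ (-Complex.I))) z) : ℂ) * Complex.log z
  have hcomp : (-((φW.symm.trans φV).toLinearEquiv :
              eigSp γ (-Complex.I) →ₗ[ℂ] eigSp γ (-Complex.I))) ∘ₗ
      ((-((φU.symm.trans φW).toLinearEquiv :
              eigSp γ (-Complex.I) →ₗ[ℂ] eigSp γ (-Complex.I))) ∘ₗ
      (-((φV.symm.trans φU).toLinearEquiv :
              eigSp γ (-Complex.I) →ₗ[ℂ] eigSp γ (-Complex.I)))) =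
      (-1 : ℂ) • LinearMap.id := by
    ext x
    simp
  have hdet := congrArg LinearMap.det hcomp
  rw [LinearMap.det_comp, LinearMap.det_comp, LinearMap.det_smul, LinearMap.det_id, mul_one,
    ← h1, ← h2, ← h3] at hdet
  have hsq1 : ∀ n : ℕ, (((-1 : ℂ)) ^ n) ^ 2 = 1 := by
    intro n
    rw [← pow_mul, mul_comm, pow_mul]
    norm_num
  have hexp : Complex.exp (2 * (S1 + S2 + S3)) = 1 := by
    have h4 := congrArg (fun w : ℂ => w ^ 2) hdet
    simp only [mul_pow, hsq1, mul_one] at h4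
    rw [two_mul, Complex.exp_add, Complex.exp_add, Complex.exp_add]
    linear_combination h4
  obtain ⟨n, hn⟩ := Complex.exp_eq_one_iff.mp hexp
  refine ⟨-n, ?_⟩
  have hpi : (Real.pi : ℂ) ≠ 0 := by exact_mod_cast Real.pi_ne_zero
  have hS : S1 + S2 + S3 = n * (Real.pi * Complex.I) := by linear_combination hn / 2
  rw [← mul_add, ← mul_add, hS]
  have hI := Complex.I_ne_zero
  push_cast
  field_simp
end
end
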